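/- arXiv:1211.4677 — 2 statements merged into one kernel-verified Lean document; each statement's English description precedes it below -/
import Mathlib

section
/- (Expansion identity for the Adini interpolant.) Let $K = [x_c - h_x, x_c + h_x] \times [y_c - h_y, y_c + h_y]$ with $h_x, h_y > 0$, let $u \in P_4$, let $p \in Q_{Ad}$ be an Adini interpolant of $u$ on $K$, and let $v \in Q_{Ad}$. Then $\int_K \nabla^2(u - p) : \nabla^2 v \, dx\,dy = -\frac{h_y^2}{3} \int_K \frac{\partial^4 u}{\partial x^2 \partial y^2} \, \frac{\partial^2 v}{\partial x^2} \, dx\,dy \; - \; \frac{h_x^2}{3} \int_K \frac{\partial^4 u}{\partial x^2 \partial y^2} \, \frac{\partial^2 v}{\partial y^2} \, dx\,dy$, where $\nabla^2 w$ denotes the Hessian matrix of $w$ and $A : B$ denotes the Frobenius inner product of matrices, so that $\nabla^2 w_1 : \nabla^2 w_2 = (w_1)_{xx}(w_2)_{xx} + 2 (w_1)_{xy}(w_2)_{xy} + (w_1)_{yy}(w_2)_{yy}$. -/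
open MvPolynomial MeasureTheory

/-- The Adini shape space `Q_Ad = P₃ + span{x³y, xy³}` as a set of real
polynomials in two variables (`X 0` is `x`, `X 1` is `y`). -/
def QAd : Set (MvPolynomial (Fin 2) ℝ) :=
  {p | ∃ q : MvPolynomial (Fin 2) ℝ, ∃ c₁ c₂ : ℝ, q.totalDegree ≤ 3 ∧
    p = q + C c₁ * (X 0 ^ 3 * X 1) + C c₂ * (X 0 * X 1 ^ 3)}

theorem totalDegree_bind₁_le_of_forall_le_one {σ τ R : Type*} [CommSemiring R]
    (f : σ → MvPolynomial τ R) (hf : ∀ i, (f i).totalDegree ≤ 1) (p : MvPolynomial σ R) :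
    (bind₁ f p).totalDegree ≤ p.totalDegree := by
  classical
  conv_lhs => rw [p.as_sum, map_sum]
  refine totalDegree_finsetSum_le fun m hm => ?_
  rw [bind₁_monomial]
  refine (totalDegree_mul _ _).trans ?_
  rw [totalDegree_C, zero_add]
  refine (totalDegree_finsetProd _ _).trans ((Finset.sum_le_sum fun i _ => ?_).trans
    (le_totalDegree hm))
  exact (totalDegree_pow _ _).trans (by simpa using Nat.mul_le_mul_left (m i) (hf i))

theorem eq_sum_range_of_totalDegree_le {R : Type*} [CommSemiring R]
    {p : MvPolynomial (Fin 2) R} {n : ℕ} (hp : p.totalDegree ≤ n) :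
    ∃ c : ℕ → ℕ → R, p = ∑ i ∈ Finset.range (n + 1), ∑ j ∈ Finset.range (n + 1 - i),
      C (c i j) * (X 0 ^ i * X 1 ^ j) := by
  classical
  refine ⟨fun i j => coeff (Finsupp.single 0 i + Finsupp.single 1 j) p, ?_⟩
  have hmon : ∀ i j (a : R), C a * (X 0 ^ i * X 1 ^ j : MvPolynomial (Fin 2) R) =
      monomial (Finsupp.single 0 i + Finsupp.single 1 j) a := by
    intro i j a
    rw [X_pow_eq_monomial, X_pow_eq_monomial, monomial_mul, C_mul_monomial]
    simp
  have hm : ∀ (i j : ℕ) (m : Fin 2 →₀ ℕ),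
      Finsupp.single 0 i + Finsupp.single 1 j = m ↔ i = m 0 ∧ j = m 1 := by
    intro i j m
    rw [Finsupp.ext_iff, Fin.forall_fin_two]
    simp
  ext m
  simp only [hmon, coeff_sum, coeff_monomial, hm]
  have hinner : ∀ i, (∑ j ∈ Finset.range (n + 1 - i),
      if i = m 0 ∧ j = m 1 then
        coeff (Finsupp.single 0 i + Finsupp.single 1 j) p else 0) =
      if i = m 0 then (if m 1 < n + 1 - i then coeff m p else 0) else 0 := by
    intro i
    split_ifs with h₁ h₂
    · rw [Finset.sum_eq_single (m 1)]
      · rw [if_pos ⟨h₁, rfl⟩, (hm _ _ m).2 ⟨h₁, rfl⟩]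
      · exact fun j _ hj => if_neg fun h => hj h.2
      · exact fun h => absurd (Finset.mem_range.2 h₂) h
    · refine Finset.sum_eq_zero fun j hj => if_neg fun h => h₂ ?_
      exact h.2 ▸ Finset.mem_range.1 hj
    · exact Finset.sum_eq_zero fun j _ => if_neg fun h => h₁ h.1
  simp only [hinner, Finset.sum_ite_eq', Finset.mem_range]
  by_cases hne : coeff m p = 0
  · simp [hne]
  · have := (le_totalDegree (mem_support_iff.2 hne)).trans hp
    rw [Finsupp.sum_fintype _ _ (fun _ => rfl), Fin.sum_univ_two] at this
    rw [if_pos (by omega), if_pos (by omega)]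

theorem eq_sum_range_sub_of_totalDegree_le {R : Type*} [CommRing R] (a b : R)
    {p : MvPolynomial (Fin 2) R} {n : ℕ} (hp : p.totalDegree ≤ n) :
    ∃ c : ℕ → ℕ → R, p = ∑ i ∈ Finset.range (n + 1), ∑ j ∈ Finset.range (n + 1 - i),
      C (c i j) * ((X 0 - C a) ^ i * (X 1 - C b) ^ j) := by
  have hdeg : (bind₁ (![X 0 + C a, X 1 + C b] : Fin 2 → MvPolynomial (Fin 2) R)
      p).totalDegree ≤ n := by
    refine (totalDegree_bind₁_le_of_forall_le_one _ (fun i => ?_) p).trans hp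
    have hX : ∀ (i : Fin 2) (r : R), (X i + C r).totalDegree ≤ 1 := fun i r =>
      (totalDegree_add _ _).trans (max_le
        ((totalDegree_monomial_le _ _).trans (by simp)) (by simp))
    revert i
    rw [Fin.forall_fin_two]
    exact ⟨hX 0 a, hX 1 b⟩
  obtain ⟨c, hc⟩ := eq_sum_range_of_totalDegree_le hdeg
  refine ⟨c, ?_⟩
  have hinv : bind₁ ![X 0 - C a, X 1 - C b] (bind₁ ![X 0 + C a, X 1 + C b] p) = p := by
    rw [bind₁_bind₁]
    refine (congrArg (fun f => bind₁ f p) (funext fun i => ?_)).trans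
      (DFunLike.congr_fun bind₁_X_left p)
    fin_cases i <;> simp
  rw [← hinv, hc]
  simp

theorem pderiv_ofNat {σ R : Type*} [CommSemiring R] (i : σ) (n : ℕ) [n.AtLeastTwo] :
    pderiv i (ofNat(n) : MvPolynomial σ R) = 0 :=
  (pderiv i).map_natCast n

theorem totalDegree_le_of_mem_QAd {p : MvPolynomial (Fin 2) ℝ} (hp : p ∈ QAd) :
    p.totalDegree ≤ 4 := by
  obtain ⟨q, c₁, c₂, hq, hpq⟩ := hp
  have hX : ∀ i : Fin 2, (X i : MvPolynomial (Fin 2) ℝ).totalDegree = 1 := totalDegree_X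
  rw [hpq]
  refine (totalDegree_add _ _).trans (max_le ((totalDegree_add _ _).trans (max_le
    (by omega) ?_)) ?_)
  · refine (totalDegree_mul _ _).trans ?_
    have h := totalDegree_mul (X 0 ^ 3 : MvPolynomial (Fin 2) ℝ) (X 1)
    simp only [totalDegree_X_pow, hX, totalDegree_C] at h ⊢
    omega
  · refine (totalDegree_mul _ _).trans ?_
    have h := totalDegree_mul (X 0 : MvPolynomial (Fin 2) ℝ) (X 1 ^ 3)
    simp only [totalDegree_X_pow, hX, totalDegree_C] at h ⊢
    omega

theorem exists_coeff_of_mem_QAd (a b : ℝ) {p : MvPolynomial (Fin 2) ℝ} (hp : p ∈ QAd) :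
    ∃ c : ℕ → ℕ → ℝ, c 4 0 = 0 ∧ c 2 2 = 0 ∧ c 0 4 = 0 ∧
      p = ∑ i ∈ Finset.range (4 + 1), ∑ j ∈ Finset.range (4 + 1 - i),
        C (c i j) * ((X 0 - C a) ^ i * (X 1 - C b) ^ j) := by
  obtain ⟨q, c₁, c₂, hq, hpq⟩ := hp
  obtain ⟨c, hc⟩ := eq_sum_range_sub_of_totalDegree_le a b
    (totalDegree_le_of_mem_QAd ⟨q, c₁, c₂, hq, hpq⟩)
  obtain ⟨d, hd⟩ := eq_sum_range_sub_of_totalDegree_le a b hq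
  have key : q + C c₁ * (X 0 ^ 3 * X 1) + C c₂ * (X 0 * X 1 ^ 3) = _ := hpq.symm.trans hc
  rw [hd] at key
  simp only [Finset.sum_range_succ, Finset.sum_range_zero, Nat.reduceAdd, Nat.reduceSub] at key
  refine ⟨c, ?_, ?_, ?_, hc⟩
  · have h := congrArg (fun r => eval ![a, b] (pderiv 0 (pderiv 0 (pderiv 0 (pderiv 0 r))))) key
    simp [pderiv_X, pderiv_ofNat] at h
    linarith
  · have h := congrArg (fun r => eval ![a, b] (pderiv 0 (pderiv 0 (pderiv 1 (pderiv 1 r))))) key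
    simp [pderiv_X, pderiv_ofNat] at h
    linarith
  · have h := congrArg (fun r => eval ![a, b] (pderiv 1 (pderiv 1 (pderiv 1 (pderiv 1 r))))) key
    simp [pderiv_X, pderiv_ofNat] at h
    linarith

theorem setIntegral_Icc_sub_pow (a h : ℝ) (hh : 0 < h) (n : ℕ) :
    ∫ x in Set.Icc (a - h) (a + h), (x - a) ^ n = (h ^ (n + 1) - (-h) ^ (n + 1)) / (n + 1) := by
  rw [integral_Icc_eq_integral_Ioc, ← intervalIntegral.integral_of_le (by linarith),
    intervalIntegral.integral_comp_sub_right (fun x => x ^ n) a, integral_pow]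
  congr <;> ring

theorem setIntegral_prod_Icc_bicubic (a b h k : ℝ) (hh : 0 < h) (hk : 0 < k)
    (c : Fin 4 → Fin 4 → ℝ) (f : ℝ × ℝ → ℝ)
    (hf : ∀ z, f z = ∑ i : Fin 4, ∑ j : Fin 4,
      c i j * ((z.1 - a) ^ (i : ℕ) * (z.2 - b) ^ (j : ℕ))) :
    ∫ z in (Set.Icc (a - h) (a + h) ×ˢ Set.Icc (b - k) (b + k) : Set (ℝ × ℝ)), f z =
      4 * h * k * (c 0 0 + c 2 0 * h ^ 2 / 3 + c 0 2 * k ^ 2 / 3 +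
        c 2 2 * h ^ 2 * k ^ 2 / 9) := by
  have hK : IsCompact (Set.Icc (a - h) (a + h) ×ˢ Set.Icc (b - k) (b + k) : Set (ℝ × ℝ)) :=
    isCompact_Icc.prod isCompact_Icc
  have hint : ∀ i j : Fin 4, IntegrableOn
      (fun z : ℝ × ℝ => c i j * ((z.1 - a) ^ (i : ℕ) * (z.2 - b) ^ (j : ℕ)))
      (Set.Icc (a - h) (a + h) ×ˢ Set.Icc (b - k) (b + k)) := fun i j =>
    ContinuousOn.integrableOn_compact hK (by fun_prop)
  simp only [hf]
  rw [integral_finsetSum _ fun i _ => integrable_finsetSum _ fun j _ => hint i j]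
  simp only [integral_finsetSum _ fun j _ => hint _ j, integral_const_mul]
  have hmul : ∀ i j : ℕ,
      ∫ z in (Set.Icc (a - h) (a + h) ×ˢ Set.Icc (b - k) (b + k) : Set (ℝ × ℝ)),
        (z.1 - a) ^ i * (z.2 - b) ^ j =
      (h ^ (i + 1) - (-h) ^ (i + 1)) / (i + 1) * ((k ^ (j + 1) - (-k) ^ (j + 1)) / (j + 1)) := by
    intro i j
    rw [← setIntegral_Icc_sub_pow a h hh, ← setIntegral_Icc_sub_pow b k hk,
      Measure.volume_eq_prod]
    exact setIntegral_prod_mul (fun x => (x - a) ^ i) (fun y => (y - b) ^ j) _ _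
  simp only [hmul, Fin.sum_univ_four, Fin.val_zero, Fin.val_one, Fin.val_two,
    show ((3 : Fin 4) : ℕ) = 3 from rfl]
  push_cast
  ring

theorem coeff_relations_of_adini_dofs_eq_zero {h k : ℝ} (hh : 0 < h) (hk : 0 < k)
    (c : ℕ → ℕ → ℝ)
    (hval : ∀ s ∈ ({-1, 1} : Set ℝ), ∀ t ∈ ({-1, 1} : Set ℝ),
      1 * c 0 0 * (s * h) ^ 0 * (t * k) ^ 0 + 1 * c 0 1 * (s * h) ^ 0 * (t * k) ^ 1 +
      1 * c 1 0 * (s * h) ^ 1 * (t * k) ^ 0 + 1 * c 0 2 * (s * h) ^ 0 * (t * k) ^ 2 +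
      1 * c 1 1 * (s * h) ^ 1 * (t * k) ^ 1 + 1 * c 2 0 * (s * h) ^ 2 * (t * k) ^ 0 +
      1 * c 0 3 * (s * h) ^ 0 * (t * k) ^ 3 + 1 * c 1 2 * (s * h) ^ 1 * (t * k) ^ 2 +
      1 * c 2 1 * (s * h) ^ 2 * (t * k) ^ 1 + 1 * c 3 0 * (s * h) ^ 3 * (t * k) ^ 0 +
      1 * c 0 4 * (s * h) ^ 0 * (t * k) ^ 4 + 1 * c 1 3 * (s * h) ^ 1 * (t * k) ^ 3 +
      1 * c 2 2 * (s * h) ^ 2 * (t * k) ^ 2 + 1 * c 3 1 * (s * h) ^ 3 * (t * k) ^ 1 +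
      1 * c 4 0 * (s * h) ^ 4 * (t * k) ^ 0 = 0)
    (hx : ∀ s ∈ ({-1, 1} : Set ℝ), ∀ t ∈ ({-1, 1} : Set ℝ),
      1 * c 1 0 * (s * h) ^ 0 * (t * k) ^ 0 + 1 * c 1 1 * (s * h) ^ 0 * (t * k) ^ 1 +
      2 * c 2 0 * (s * h) ^ 1 * (t * k) ^ 0 + 1 * c 1 2 * (s * h) ^ 0 * (t * k) ^ 2 +
      2 * c 2 1 * (s * h) ^ 1 * (t * k) ^ 1 + 3 * c 3 0 * (s * h) ^ 2 * (t * k) ^ 0 +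
      1 * c 1 3 * (s * h) ^ 0 * (t * k) ^ 3 + 2 * c 2 2 * (s * h) ^ 1 * (t * k) ^ 2 +
      3 * c 3 1 * (s * h) ^ 2 * (t * k) ^ 1 + 4 * c 4 0 * (s * h) ^ 3 * (t * k) ^ 0 = 0)
    (hy : ∀ s ∈ ({-1, 1} : Set ℝ), ∀ t ∈ ({-1, 1} : Set ℝ),
      1 * c 0 1 * (s * h) ^ 0 * (t * k) ^ 0 + 2 * c 0 2 * (s * h) ^ 0 * (t * k) ^ 1 +
      1 * c 1 1 * (s * h) ^ 1 * (t * k) ^ 0 + 3 * c 0 3 * (s * h) ^ 0 * (t * k) ^ 2 +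
      2 * c 1 2 * (s * h) ^ 1 * (t * k) ^ 1 + 1 * c 2 1 * (s * h) ^ 2 * (t * k) ^ 0 +
      4 * c 0 4 * (s * h) ^ 0 * (t * k) ^ 3 + 3 * c 1 3 * (s * h) ^ 1 * (t * k) ^ 2 +
      2 * c 2 2 * (s * h) ^ 2 * (t * k) ^ 1 + 1 * c 3 1 * (s * h) ^ 3 * (t * k) ^ 0 = 0) :
    c 1 1 = 0 ∧ c 2 1 = 0 ∧ c 1 2 = 0 ∧ c 3 0 = 0 ∧ c 0 3 = 0 ∧ c 3 1 = 0 ∧ c 1 3 = 0 ∧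
      c 2 0 = -2 * c 4 0 * h ^ 2 - c 2 2 * k ^ 2 ∧
      c 0 2 = -2 * c 0 4 * k ^ 2 - c 2 2 * h ^ 2 := by
  simp only [Set.mem_insert_iff, Set.mem_singleton_iff, forall_eq_or_imp, forall_eq]
    at hval hx hy
  obtain ⟨⟨v₁, v₂⟩, v₃, v₄⟩ := hval
  obtain ⟨⟨x₁, x₂⟩, x₃, x₄⟩ := hx
  obtain ⟨⟨y₁, y₂⟩, y₃, y₄⟩ := hy
  have h0 := hh.ne'
  have k0 := hk.ne'
  have c21 : c 2 1 = 0 := by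
    have : (8 * h * k) * c 2 1 = 0 := by linear_combination x₁ - x₂ - x₃ + x₄
    simpa [h0, k0] using this
  have c12 : c 1 2 = 0 := by
    have : (8 * h * k) * c 1 2 = 0 := by linear_combination y₁ - y₂ - y₃ + y₄
    simpa [h0, k0] using this
  have c30 : c 3 0 = 0 := by
    have : (8 * h ^ 3) * c 3 0 = 0 := by
      linear_combination h * (x₁ + x₂ + x₃ + x₄) - (v₃ + v₄ - v₁ - v₂)
    simpa [h0, k0] using this
  have c03 : c 0 3 = 0 := by
    have : (8 * k ^ 3) * c 0 3 = 0 := by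
      linear_combination k * (y₁ + y₂ + y₃ + y₄) - (v₂ + v₄ - v₁ - v₃)
    simpa [h0, k0] using this
  have c31 : c 3 1 = 0 := by
    have : (8 * h ^ 3 * k) * c 3 1 = 0 := by
      linear_combination h * (x₂ + x₄ - x₁ - x₃) - (v₁ - v₂ - v₃ + v₄)
    simpa [h0, k0] using this
  have c13 : c 1 3 = 0 := by
    have : (8 * h * k ^ 3) * c 1 3 = 0 := by
      linear_combination k * (y₃ + y₄ - y₁ - y₂) - (v₁ - v₂ - v₃ + v₄)
    simpa [h0, k0] using this
  have c11 : c 1 1 = 0 := by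
    have : (4 * h * k) * c 1 1 = 0 := by
      linear_combination (v₁ - v₂ - v₃ + v₄) - 4 * h ^ 3 * k * c31 - 4 * h * k ^ 3 * c13
    simpa [h0, k0] using this
  refine ⟨c11, c21, c12, c30, c03, c31, c13, ?_, ?_⟩
  · have : (8 * h) * (c 2 0 - (-2 * c 4 0 * h ^ 2 - c 2 2 * k ^ 2)) = 0 := by
      linear_combination x₃ + x₄ - x₁ - x₂
    exact sub_eq_zero.1 (by simpa [h0] using this)
  · have : (8 * k) * (c 0 2 - (-2 * c 0 4 * k ^ 2 - c 2 2 * h ^ 2)) = 0 := by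
      linear_combination y₂ + y₄ - y₁ - y₃
    exact sub_eq_zero.1 (by simpa [k0] using this)

theorem eval_pderiv_quartic (a b x y : ℝ) (c : ℕ → ℕ → ℝ) (p : MvPolynomial (Fin 2) ℝ)
    (hp : p = ∑ i ∈ Finset.range (4 + 1), ∑ j ∈ Finset.range (4 + 1 - i),
      C (c i j) * ((X 0 - C a) ^ i * (X 1 - C b) ^ j)) :
    eval ![x, y] p =
      1 * c 0 0 * (x - a) ^ 0 * (y - b) ^ 0 + 1 * c 0 1 * (x - a) ^ 0 * (y - b) ^ 1 +
      1 * c 1 0 * (x - a) ^ 1 * (y - b) ^ 0 + 1 * c 0 2 * (x - a) ^ 0 * (y - b) ^ 2 +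
      1 * c 1 1 * (x - a) ^ 1 * (y - b) ^ 1 + 1 * c 2 0 * (x - a) ^ 2 * (y - b) ^ 0 +
      1 * c 0 3 * (x - a) ^ 0 * (y - b) ^ 3 + 1 * c 1 2 * (x - a) ^ 1 * (y - b) ^ 2 +
      1 * c 2 1 * (x - a) ^ 2 * (y - b) ^ 1 + 1 * c 3 0 * (x - a) ^ 3 * (y - b) ^ 0 +
      1 * c 0 4 * (x - a) ^ 0 * (y - b) ^ 4 + 1 * c 1 3 * (x - a) ^ 1 * (y - b) ^ 3 +
      1 * c 2 2 * (x - a) ^ 2 * (y - b) ^ 2 + 1 * c 3 1 * (x - a) ^ 3 * (y - b) ^ 1 +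
      1 * c 4 0 * (x - a) ^ 4 * (y - b) ^ 0 ∧
    eval ![x, y] (pderiv 0 p) =
      1 * c 1 0 * (x - a) ^ 0 * (y - b) ^ 0 + 1 * c 1 1 * (x - a) ^ 0 * (y - b) ^ 1 +
      2 * c 2 0 * (x - a) ^ 1 * (y - b) ^ 0 + 1 * c 1 2 * (x - a) ^ 0 * (y - b) ^ 2 +
      2 * c 2 1 * (x - a) ^ 1 * (y - b) ^ 1 + 3 * c 3 0 * (x - a) ^ 2 * (y - b) ^ 0 +
      1 * c 1 3 * (x - a) ^ 0 * (y - b) ^ 3 + 2 * c 2 2 * (x - a) ^ 1 * (y - b) ^ 2 +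
      3 * c 3 1 * (x - a) ^ 2 * (y - b) ^ 1 + 4 * c 4 0 * (x - a) ^ 3 * (y - b) ^ 0 ∧
    eval ![x, y] (pderiv 1 p) =
      1 * c 0 1 * (x - a) ^ 0 * (y - b) ^ 0 + 2 * c 0 2 * (x - a) ^ 0 * (y - b) ^ 1 +
      1 * c 1 1 * (x - a) ^ 1 * (y - b) ^ 0 + 3 * c 0 3 * (x - a) ^ 0 * (y - b) ^ 2 +
      2 * c 1 2 * (x - a) ^ 1 * (y - b) ^ 1 + 1 * c 2 1 * (x - a) ^ 2 * (y - b) ^ 0 +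
      4 * c 0 4 * (x - a) ^ 0 * (y - b) ^ 3 + 3 * c 1 3 * (x - a) ^ 1 * (y - b) ^ 2 +
      2 * c 2 2 * (x - a) ^ 2 * (y - b) ^ 1 + 1 * c 3 1 * (x - a) ^ 3 * (y - b) ^ 0 ∧
    eval ![x, y] (pderiv 0 (pderiv 0 p)) =
      2 * c 2 0 * (x - a) ^ 0 * (y - b) ^ 0 + 2 * c 2 1 * (x - a) ^ 0 * (y - b) ^ 1 +
      6 * c 3 0 * (x - a) ^ 1 * (y - b) ^ 0 + 2 * c 2 2 * (x - a) ^ 0 * (y - b) ^ 2 +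
      6 * c 3 1 * (x - a) ^ 1 * (y - b) ^ 1 + 12 * c 4 0 * (x - a) ^ 2 * (y - b) ^ 0 ∧
    eval ![x, y] (pderiv 0 (pderiv 1 p)) =
      1 * c 1 1 * (x - a) ^ 0 * (y - b) ^ 0 + 2 * c 1 2 * (x - a) ^ 0 * (y - b) ^ 1 +
      2 * c 2 1 * (x - a) ^ 1 * (y - b) ^ 0 + 3 * c 1 3 * (x - a) ^ 0 * (y - b) ^ 2 +
      4 * c 2 2 * (x - a) ^ 1 * (y - b) ^ 1 + 3 * c 3 1 * (x - a) ^ 2 * (y - b) ^ 0 ∧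
    eval ![x, y] (pderiv 1 (pderiv 1 p)) =
      2 * c 0 2 * (x - a) ^ 0 * (y - b) ^ 0 + 6 * c 0 3 * (x - a) ^ 0 * (y - b) ^ 1 +
      2 * c 1 2 * (x - a) ^ 1 * (y - b) ^ 0 + 12 * c 0 4 * (x - a) ^ 0 * (y - b) ^ 2 +
      6 * c 1 3 * (x - a) ^ 1 * (y - b) ^ 1 + 2 * c 2 2 * (x - a) ^ 2 * (y - b) ^ 0 ∧
    eval ![x, y] (pderiv 0 (pderiv 0 (pderiv 1 (pderiv 1 p)))) =
      4 * c 2 2 * (x - a) ^ 0 * (y - b) ^ 0 := by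
  simp only [Finset.sum_range_succ, Finset.sum_range_zero, Nat.reduceAdd, Nat.reduceSub] at hp
  subst hp
  refine ⟨?_, ?_, ?_, ?_, ?_, ?_, ?_⟩ <;> simp [pderiv_X, pderiv_ofNat] <;> ring

/-- Expansion identity for the Adini interpolant on a rectangle
`K = [x_c-h_x, x_c+h_x] × [y_c-h_y, y_c+h_y]`: for `u ∈ P₄`, `p ∈ Q_Ad`
an Adini interpolant of `u` on `K`, and any `v ∈ Q_Ad`,
`∫_K ∇²(u-p) : ∇²v = -(h_y²/3) ∫_K u_xxyy v_xx - (h_x²/3) ∫_K u_xxyy v_yy`. -/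
theorem adini_expansion_identity (xc yc hx hy : ℝ) (hhx : 0 < hx) (hhy : 0 < hy)
    (u p v : MvPolynomial (Fin 2) ℝ) (hu : u.totalDegree ≤ 4) (hp : p ∈ QAd)
    (hv : v ∈ QAd)
    (hval : ∀ s ∈ ({-1, 1} : Set ℝ), ∀ t ∈ ({-1, 1} : Set ℝ),
      eval ![xc + s * hx, yc + t * hy] p = eval ![xc + s * hx, yc + t * hy] u)
    (hgrad : ∀ s ∈ ({-1, 1} : Set ℝ), ∀ t ∈ ({-1, 1} : Set ℝ),
      eval ![xc + s * hx, yc + t * hy] (pderiv 0 p) =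
        eval ![xc + s * hx, yc + t * hy] (pderiv 0 u) ∧
      eval ![xc + s * hx, yc + t * hy] (pderiv 1 p) =
        eval ![xc + s * hx, yc + t * hy] (pderiv 1 u)) :
    (∫ z in (Set.Icc (xc - hx) (xc + hx) ×ˢ Set.Icc (yc - hy) (yc + hy) : Set (ℝ × ℝ)),
        (eval ![z.1, z.2] (pderiv 0 (pderiv 0 (u - p))) *
            eval ![z.1, z.2] (pderiv 0 (pderiv 0 v)) +
          2 * eval ![z.1, z.2] (pderiv 0 (pderiv 1 (u - p))) *
            eval ![z.1, z.2] (pderiv 0 (pderiv 1 v)) +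
          eval ![z.1, z.2] (pderiv 1 (pderiv 1 (u - p))) *
            eval ![z.1, z.2] (pderiv 1 (pderiv 1 v)))) =
      -(hy ^ 2 / 3) *
        (∫ z in (Set.Icc (xc - hx) (xc + hx) ×ˢ Set.Icc (yc - hy) (yc + hy) : Set (ℝ × ℝ)),
          eval ![z.1, z.2] (pderiv 0 (pderiv 0 (pderiv 1 (pderiv 1 u)))) *
            eval ![z.1, z.2] (pderiv 0 (pderiv 0 v))) -
      (hx ^ 2 / 3) *
        (∫ z in (Set.Icc (xc - hx) (xc + hx) ×ˢ Set.Icc (yc - hy) (yc + hy) : Set (ℝ × ℝ)),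
          eval ![z.1, z.2] (pderiv 0 (pderiv 0 (pderiv 1 (pderiv 1 u)))) *
            eval ![z.1, z.2] (pderiv 1 (pderiv 1 v))) := by
  obtain ⟨e, he⟩ := eq_sum_range_sub_of_totalDegree_le xc yc
    ((totalDegree_sub u p).trans (max_le hu (totalDegree_le_of_mem_QAd hp)))
  obtain ⟨d, d40, d22, d04, hd⟩ := exists_coeff_of_mem_QAd xc yc hv
  obtain ⟨q, -, q22, -, hq⟩ := exists_coeff_of_mem_QAd xc yc hp
  have hE := fun x y => eval_pderiv_quartic xc yc x y e _ he
  have hV := fun x y => eval_pderiv_quartic xc yc x y d _ hd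
  have hu22 : ∀ x y, eval ![x, y] (pderiv 0 (pderiv 0 (pderiv 1 (pderiv 1 u)))) = 4 * e 2 2 := by
    intro x y
    have h1 := (hE x y).2.2.2.2.2.2
    have h2 := (eval_pderiv_quartic xc yc x y q _ hq).2.2.2.2.2.2
    simp only [map_sub] at h1
    linear_combination h1 + h2 + 4 * q22
  obtain ⟨e11, e21, e12, e30, e03, e31, e13, e20, e02⟩ :=
    coeff_relations_of_adini_dofs_eq_zero hhx hhy e
      (fun s hs t ht => by
        have h := (hE (xc + s * hx) (yc + t * hy)).1
        rw [map_sub, hval s hs t ht, sub_self] at h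
        simpa only [add_sub_cancel_left] using h.symm)
      (fun s hs t ht => by
        have h := (hE (xc + s * hx) (yc + t * hy)).2.1
        rw [map_sub, map_sub, (hgrad s hs t ht).1, sub_self] at h
        simpa only [add_sub_cancel_left] using h.symm)
      (fun s hs t ht => by
        have h := (hE (xc + s * hx) (yc + t * hy)).2.2.1
        rw [map_sub, map_sub, (hgrad s hs t ht).2, sub_self] at h
        simpa only [add_sub_cancel_left] using h.symm)
  have hVxx : ∀ x y, eval ![x, y] (pderiv 0 (pderiv 0 v)) = 2 * d 2 0 + 6 * d 3 0 * (x - xc) +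
      2 * d 2 1 * (y - yc) + 6 * d 3 1 * (x - xc) * (y - yc) := by
    intro x y
    rw [(hV x y).2.2.2.1, d40, d22]
    ring
  have hVxy : ∀ x y, eval ![x, y] (pderiv 0 (pderiv 1 v)) = d 1 1 + 2 * d 2 1 * (x - xc) +
      2 * d 1 2 * (y - yc) + 3 * d 3 1 * (x - xc) ^ 2 + 3 * d 1 3 * (y - yc) ^ 2 := by
    intro x y
    rw [(hV x y).2.2.2.2.1, d22]
    ring
  have hVyy : ∀ x y, eval ![x, y] (pderiv 1 (pderiv 1 v)) = 2 * d 0 2 + 6 * d 0 3 * (y - yc) +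
      2 * d 1 2 * (x - xc) + 6 * d 1 3 * (x - xc) * (y - yc) := by
    intro x y
    rw [(hV x y).2.2.2.2.2.1, d04, d22]
    ring
  have hExx : ∀ x y, eval ![x, y] (pderiv 0 (pderiv 0 (u - p))) =
      4 * e 4 0 * (3 * (x - xc) ^ 2 - hx ^ 2) + 2 * e 2 2 * ((y - yc) ^ 2 - hy ^ 2) := by
    intro x y
    rw [(hE x y).2.2.2.1, e20, e21, e30, e31]
    ring
  have hExy : ∀ x y, eval ![x, y] (pderiv 0 (pderiv 1 (u - p))) =
      4 * e 2 2 * (x - xc) * (y - yc) := by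
    intro x y
    rw [(hE x y).2.2.2.2.1, e11, e21, e12, e31, e13]
    ring
  have hEyy : ∀ x y, eval ![x, y] (pderiv 1 (pderiv 1 (u - p))) =
      4 * e 0 4 * (3 * (y - yc) ^ 2 - hy ^ 2) + 2 * e 2 2 * ((x - xc) ^ 2 - hx ^ 2) := by
    intro x y
    rw [(hE x y).2.2.2.2.2.1, e02, e12, e03, e13]
    ring
  simp only [hu22, hVxx, hVxy, hVyy, hExx, hExy, hEyy]
  rw [setIntegral_prod_Icc_bicubic xc yc hx hy hhx hhy ![
      ![(-8) * d 2 0 * e 4 0 * hx ^ 2 + (-4) * d 2 0 * e 2 2 * hy ^ 2 +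
          (-8) * d 0 2 * e 0 4 * hy ^ 2 + (-4) * d 0 2 * e 2 2 * hx ^ 2,
        (-8) * d 2 1 * e 4 0 * hx ^ 2 + (-4) * d 2 1 * e 2 2 * hy ^ 2 +
          (-24) * d 0 3 * e 0 4 * hy ^ 2 + (-12) * d 0 3 * e 2 2 * hx ^ 2,
        4 * d 2 0 * e 2 2 + 24 * d 0 2 * e 0 4,
        4 * d 2 1 * e 2 2 + 72 * d 0 3 * e 0 4],
      ![(-24) * d 3 0 * e 4 0 * hx ^ 2 + (-12) * d 3 0 * e 2 2 * hy ^ 2 +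
          (-8) * d 1 2 * e 0 4 * hy ^ 2 + (-4) * d 1 2 * e 2 2 * hx ^ 2,
        (-24) * d 3 1 * e 4 0 * hx ^ 2 + (-12) * d 3 1 * e 2 2 * hy ^ 2 + 8 * d 1 1 * e 2 2 +
          (-24) * d 1 3 * e 0 4 * hy ^ 2 + (-12) * d 1 3 * e 2 2 * hx ^ 2,
        12 * d 3 0 * e 2 2 + 16 * d 1 2 * e 2 2 + 24 * d 1 2 * e 0 4,
        12 * d 3 1 * e 2 2 + 24 * d 1 3 * e 2 2 + 72 * d 1 3 * e 0 4],
      ![24 * d 2 0 * e 4 0 + 4 * d 0 2 * e 2 2,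
        24 * d 2 1 * e 4 0 + 16 * d 2 1 * e 2 2 + 12 * d 0 3 * e 2 2, 0, 0],
      ![72 * d 3 0 * e 4 0 + 4 * d 1 2 * e 2 2,
        72 * d 3 1 * e 4 0 + 24 * d 3 1 * e 2 2 + 12 * d 1 3 * e 2 2, 0, 0]] _ fun z => by
      simp [Fin.sum_univ_succ]
      ring,
    setIntegral_prod_Icc_bicubic xc yc hx hy hhx hhy ![
      ![8 * d 2 0 * e 2 2,
        8 * d 2 1 * e 2 2, 0, 0],
      ![24 * d 3 0 * e 2 2,
        24 * d 3 1 * e 2 2, 0, 0],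
      ![0, 0, 0, 0],
      ![0, 0, 0, 0]] _ fun z => by
      simp [Fin.sum_univ_succ]
      ring,
    setIntegral_prod_Icc_bicubic xc yc hx hy hhx hhy ![
      ![8 * d 0 2 * e 2 2,
        24 * d 0 3 * e 2 2, 0, 0],
      ![8 * d 1 2 * e 2 2,
        24 * d 1 3 * e 2 2, 0, 0],
      ![0, 0, 0, 0],
      ![0, 0, 0, 0]] _ fun z => by
      simp [Fin.sum_univ_succ]
      ring]
  simp
  ring
end

section
/- Let $K = [x_c - h_x, x_c + h_x] \times [y_c - h_y, y_c + h_y]$ with $h_x, h_y > 0$, let $u \in P_4$, let $p \in Q_{Ad}$ be an Adini interpolant of $u$ on $K$, and let $v \in Q_{Ad}$. Then $\int_K \frac{\partial^2 (u - p)}{\partial x^2} \, \frac{\partial^2 v}{\partial x^2} \, dx\,dy = -\frac{h_y^2}{3} \int_K \frac{\partial^4 u}{\partial x^2 \partial y^2} \, \frac{\partial^2 v}{\partial x^2} \, dx\,dy$. -/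
open MvPolynomial MeasureTheory

/-- A bivariate polynomial of total degree at most `n` is a combination of the monomials
`x ^ i * y ^ j` with `i + j ≤ n`. -/
lemma MvPolynomial.exists_eq_sum_of_totalDegree_le (n : ℕ) (f : MvPolynomial (Fin 2) ℝ)
    (hf : f.totalDegree ≤ n) :
    ∃ a : ℕ → ℕ → ℝ, f = ∑ i ∈ Finset.range (n + 1), ∑ j ∈ Finset.range (n + 1 - i),
      C (a i j) * (X 0 ^ i * X 1 ^ j) := by
  have hsum : ∀ t : Finset (Fin 2 →₀ ℕ), t ⊆ f.support →
      ∃ a : ℕ → ℕ → ℝ, ∑ s ∈ t, monomial s (coeff s f) =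
        ∑ i ∈ Finset.range (n + 1), ∑ j ∈ Finset.range (n + 1 - i),
          C (a i j) * (X 0 ^ i * X 1 ^ j) := by
    classical
    intro t
    induction t using Finset.induction_on with
    | empty => exact fun _ => ⟨0, by simp⟩
    | insert s t hs ih =>
      intro hst
      obtain ⟨a, ha⟩ := ih fun x hx => hst (Finset.mem_insert_of_mem hx)
      have hdeg : s 0 + s 1 ≤ n := by
        have h := (le_totalDegree (hst (Finset.mem_insert_self s t))).trans hf
        rwa [Finsupp.sum_fintype _ _ fun _ => rfl, Fin.sum_univ_two] at h
      refine ⟨fun i j => (if i = s 0 then if j = s 1 then coeff s f else 0 else 0) + a i j, ?_⟩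
      rw [Finset.sum_insert hs, ha]
      simp only [C_add, add_mul, Finset.sum_add_distrib]
      congr 1
      rw [Finset.sum_eq_single (s 0), Finset.sum_eq_single (s 1)]
      · simp [monomial_eq, Finsupp.prod_fintype]
      · intro j _ hj
        simp [hj]
      · intro h
        exact absurd (Finset.mem_range.2 (by omega)) h
      · intro i _ hi
        simp [hi]
      · intro h
        exact absurd (Finset.mem_range.2 (by omega)) h
  obtain ⟨a, ha⟩ := hsum f.support subset_rfl
  exact ⟨a, (as_sum f).trans ha⟩

/-- Taylor expansion about `(x, y)` of a bivariate polynomial of total degree at most `n`. -/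
lemma MvPolynomial.exists_eq_taylor_of_totalDegree_le (n : ℕ) (x y : ℝ)
    (f : MvPolynomial (Fin 2) ℝ) (hf : f.totalDegree ≤ n) :
    ∃ a : ℕ → ℕ → ℝ, f = ∑ i ∈ Finset.range (n + 1), ∑ j ∈ Finset.range (n + 1 - i),
      C (a i j) * ((X 0 - C x) ^ i * (X 1 - C y) ^ j) := by
  set g : MvPolynomial (Fin 2) ℝ := aeval ![X 0 + C x, X 1 + C y] f with hg
  have hshift : ∀ (z : ℝ) (k : Fin 2),
      ((X k + C z : MvPolynomial (Fin 2) ℝ)).totalDegree ≤ 1 := fun z k =>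
    (totalDegree_add _ _).trans (by simp)
  have hgdeg : g.totalDegree ≤ n := by
    obtain ⟨b, hb⟩ := exists_eq_sum_of_totalDegree_le n f hf
    rw [hg, hb, map_sum]
    refine totalDegree_finsetSum_le fun i hi => ?_
    rw [map_sum]
    refine totalDegree_finsetSum_le fun j hj => ?_
    rw [Finset.mem_range] at hi hj
    have h₀ := (totalDegree_pow (X 0 + C x : MvPolynomial (Fin 2) ℝ) i).trans
      (Nat.mul_le_mul_left i (hshift x 0))
    have h₁ := (totalDegree_pow (X 1 + C y : MvPolynomial (Fin 2) ℝ) j).trans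
      (Nat.mul_le_mul_left j (hshift y 1))
    have h₂ := totalDegree_mul (C (b i j))
      ((X 0 + C x : MvPolynomial (Fin 2) ℝ) ^ i * (X 1 + C y) ^ j)
    have h₃ := totalDegree_mul ((X 0 + C x : MvPolynomial (Fin 2) ℝ) ^ i) ((X 1 + C y) ^ j)
    rw [totalDegree_C] at h₂
    simp only [map_mul, map_pow, aeval_X, aeval_C, algebraMap_eq, Matrix.cons_val_zero,
      Matrix.cons_val_one]
    omega
  obtain ⟨a, ha⟩ := exists_eq_sum_of_totalDegree_le n g hgdeg
  refine ⟨a, ?_⟩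
  have hinv : aeval ![X 0 - C x, X 1 - C y] g = f := by
    rw [hg, ← AlgHom.comp_apply]
    have : (aeval ![X 0 - C x, X 1 - C y]).comp (aeval ![X 0 + C x, X 1 + C y]) =
        AlgHom.id ℝ (MvPolynomial (Fin 2) ℝ) := by
      ext k : 1
      fin_cases k <;> simp [← algebraMap_eq]
    rw [this, AlgHom.id_apply]
  rw [← hinv, ha]
  simp [← algebraMap_eq]

/-- Partial derivatives of numerals vanish. -/
lemma MvPolynomial.pderiv_ofNat (k : Fin 2) (n : ℕ) [n.AtLeastTwo] :
    pderiv k (ofNat(n) : MvPolynomial (Fin 2) ℝ) = 0 :=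
  (pderiv k).map_natCast n

/-- The second `x`-derivative of an Adini function is bilinear. -/
lemma QAd.exists_eval_pderiv_pderiv_eq (xc yc : ℝ) {v : MvPolynomial (Fin 2) ℝ} (hv : v ∈ QAd) :
    ∃ α β γ δ : ℝ, ∀ x y : ℝ, eval ![x, y] (pderiv 0 (pderiv 0 v)) =
      α + β * (x - xc) + γ * (y - yc) + δ * ((x - xc) * (y - yc)) := by
  obtain ⟨q, c₁, c₂, hq, rfl⟩ := hv
  obtain ⟨a, rfl⟩ := exists_eq_sum_of_totalDegree_le 3 q hq
  refine ⟨2 * a 2 0 + 6 * a 3 0 * xc + 2 * a 2 1 * yc + 6 * c₁ * (xc * yc),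
    6 * a 3 0 + 6 * c₁ * yc, 2 * a 2 1 + 6 * c₁ * xc, 6 * c₁, fun x y => ?_⟩
  simp [Finset.sum_range_succ, Derivation.leibniz, Derivation.leibniz_pow, pderiv_X, pderiv_ofNat]
  ring

lemma QAd.totalDegree_le {v : MvPolynomial (Fin 2) ℝ} (hv : v ∈ QAd) : v.totalDegree ≤ 4 := by
  obtain ⟨q, c₁, c₂, hq, rfl⟩ := hv
  have hmon : ∀ (c : ℝ) (i j : ℕ), i + j ≤ 4 →
      (C c * (X 0 ^ i * X 1 ^ j) : MvPolynomial (Fin 2) ℝ).totalDegree ≤ 4 := by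
    intro c i j hij
    have h₁ := totalDegree_mul (C c) (X 0 ^ i * X 1 ^ j : MvPolynomial (Fin 2) ℝ)
    have h₂ := totalDegree_mul (X 0 ^ i : MvPolynomial (Fin 2) ℝ) (X 1 ^ j)
    rw [totalDegree_C] at h₁
    rw [totalDegree_X_pow, totalDegree_X_pow] at h₂
    omega
  have h₁ := hmon c₁ 3 1 (by norm_num)
  have h₂ := hmon c₂ 1 3 (by norm_num)
  rw [pow_one] at h₁ h₂
  exact (totalDegree_add _ _).trans (max_le
    ((totalDegree_add _ _).trans (max_le (hq.trans (by norm_num)) h₁)) h₂)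

lemma QAd.pderiv_xxyy_eq_zero {v : MvPolynomial (Fin 2) ℝ} (hv : v ∈ QAd) :
    pderiv 0 (pderiv 0 (pderiv 1 (pderiv 1 v))) = 0 := by
  obtain ⟨q, c₁, c₂, hq, rfl⟩ := hv
  obtain ⟨a, rfl⟩ := exists_eq_sum_of_totalDegree_le 3 q hq
  simp [Finset.sum_range_succ, Derivation.leibniz, Derivation.leibniz_pow, pderiv_X, pderiv_ofNat]

/-- The bilinear functions are orthogonal on a rectangle to the second Legendre polynomials
in each variable. -/
lemma integral_legendre_mul_bilinear_eq_zero (xc yc hx hy A B α β γ δ : ℝ) (hhx : 0 < hx)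
    (hhy : 0 < hy) :
    ∫ z in (Set.Icc (xc - hx) (xc + hx) ×ˢ Set.Icc (yc - hy) (yc + hy) : Set (ℝ × ℝ)),
      (A * (3 * (z.1 - xc) ^ 2 - hx ^ 2) + B * (3 * (z.2 - yc) ^ 2 - hy ^ 2)) *
        (α + β * (z.1 - xc) + γ * (z.2 - yc) + δ * ((z.1 - xc) * (z.2 - yc))) = 0 := by
  rw [Measure.volume_eq_prod, setIntegral_prod]
  · have inner : ∀ x : ℝ, ∫ y in Set.Icc (yc - hy) (yc + hy),
        (A * (3 * (x - xc) ^ 2 - hx ^ 2) + B * (3 * (y - yc) ^ 2 - hy ^ 2)) *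
          (α + β * (x - xc) + γ * (y - yc) + δ * ((x - xc) * (y - yc))) =
        2 * hy * A * ((3 * (x - xc) ^ 2 - hx ^ 2) * (α + β * (x - xc))) := by
      intro x
      rw [integral_Icc_eq_integral_Ioc, ← intervalIntegral.integral_of_le (by linarith),
        intervalIntegral.integral_eq_sub_of_hasDerivAt
          (f := fun y => A * (3 * (x - xc) ^ 2 - hx ^ 2) *
              ((α + β * (x - xc)) * (y - yc) + (γ + δ * (x - xc)) * ((y - yc) ^ 2 / 2)) +
            B * ((α + β * (x - xc)) * ((y - yc) ^ 3 - hy ^ 2 * (y - yc)) +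
              (γ + δ * (x - xc)) * (3 / 4 * (y - yc) ^ 4 - hy ^ 2 * (y - yc) ^ 2 / 2)))]
      · ring
      · intro y _
        have h := (hasDerivAt_id' y).sub_const yc
        refine HasDerivAt.congr_deriv ((((h.const_mul (α + β * (x - xc))).add
          (((h.pow 2).div_const 2).const_mul (γ + δ * (x - xc)))).const_mul
            (A * (3 * (x - xc) ^ 2 - hx ^ 2))).add
          (((((h.pow 3).sub (h.const_mul (hy ^ 2))).const_mul (α + β * (x - xc))).add
            ((((h.pow 4).const_mul (3 / 4)).sub
              (((h.pow 2).const_mul (hy ^ 2)).div_const 2)).const_mul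
                (γ + δ * (x - xc)))).const_mul B)) ?_
        push_cast
        ring
      · exact Continuous.intervalIntegrable (by fun_prop) _ _
    simp only [inner]
    rw [integral_Icc_eq_integral_Ioc, ← intervalIntegral.integral_of_le (by linarith),
      intervalIntegral.integral_eq_sub_of_hasDerivAt
        (f := fun x => 2 * hy * A * (α * ((x - xc) ^ 3 - hx ^ 2 * (x - xc)) +
          β * (3 / 4 * (x - xc) ^ 4 - hx ^ 2 * (x - xc) ^ 2 / 2)))]
    · ring
    · intro x _
      have h := (hasDerivAt_id' x).sub_const xc
      refine HasDerivAt.congr_deriv (((((h.pow 3).sub (h.const_mul (hx ^ 2))).const_mul α).add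
        ((((h.pow 4).const_mul (3 / 4)).sub
          (((h.pow 2).const_mul (hx ^ 2)).div_const 2)).const_mul β)).const_mul
            (2 * hy * A)) ?_
      push_cast
      ring
    · exact Continuous.intervalIntegrable (by fun_prop) _ _
  · exact ContinuousOn.integrableOn_compact (isCompact_Icc.prod isCompact_Icc) (by fun_prop)

/-- If a quartic and its `x`-derivative vanish at the vertices of a rectangle, then its second
`x`-derivative, corrected by its mixed fourth derivative, is a combination of second Legendre
polynomials. -/
lemma exists_eval_pderiv_pderiv_eq_legendre {xc yc hx hy : ℝ} (hhx : 0 < hx) (hhy : 0 < hy)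
    {e : MvPolynomial (Fin 2) ℝ} (he : e.totalDegree ≤ 4)
    (hval : ∀ s ∈ ({-1, 1} : Set ℝ), ∀ t ∈ ({-1, 1} : Set ℝ),
      eval ![xc + s * hx, yc + t * hy] e = 0)
    (hdx : ∀ s ∈ ({-1, 1} : Set ℝ), ∀ t ∈ ({-1, 1} : Set ℝ),
      eval ![xc + s * hx, yc + t * hy] (pderiv 0 e) = 0) :
    ∃ A B : ℝ, ∀ x y : ℝ, eval ![x, y] (pderiv 0 (pderiv 0 e)) +
        hy ^ 2 / 3 * eval ![x, y] (pderiv 0 (pderiv 0 (pderiv 1 (pderiv 1 e)))) =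
      A * (3 * (x - xc) ^ 2 - hx ^ 2) + B * (3 * (y - yc) ^ 2 - hy ^ 2) := by
  obtain ⟨a, rfl⟩ := exists_eq_taylor_of_totalDegree_le 4 xc yc e he
  have hv₁ := hval (-1) (by simp) (-1) (by simp)
  have hv₂ := hval (-1) (by simp) 1 (by simp)
  have hv₃ := hval 1 (by simp) (-1) (by simp)
  have hv₄ := hval 1 (by simp) 1 (by simp)
  have hd₁ := hdx (-1) (by simp) (-1) (by simp)
  have hd₂ := hdx (-1) (by simp) 1 (by simp)
  have hd₃ := hdx 1 (by simp) (-1) (by simp)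
  have hd₄ := hdx 1 (by simp) 1 (by simp)
  clear hval hdx
  simp [Finset.sum_range_succ, Derivation.leibniz, Derivation.leibniz_pow, pderiv_X]
    at hv₁ hv₂ hv₃ hv₄ hd₁ hd₂ hd₃ hd₄
  have h₂₀ : a 2 0 = -2 * a 4 0 * hx ^ 2 - a 2 2 * hy ^ 2 := by
    apply mul_left_cancel₀ hhx.ne'
    linear_combination (hd₃ + hd₄ - hd₁ - hd₂) / 8
  have h₃₀ : a 3 0 = 0 := by
    have : hx ^ 3 * a 3 0 = 0 := by
      linear_combination hx * (hd₁ + hd₂ + hd₃ + hd₄) / 8 - (hv₃ + hv₄ - hv₁ - hv₂) / 8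
    simpa [hhx.ne'] using this
  have h₂₁ : a 2 1 = 0 := by
    have : hx * hy * a 2 1 = 0 := by
      linear_combination (hd₄ - hd₃ - hd₂ + hd₁) / 8
    simpa [hhx.ne', hhy.ne'] using this
  have h₃₁ : a 3 1 = 0 := by
    have : hx ^ 3 * hy * a 3 1 = 0 := by
      linear_combination hx * (hd₄ - hd₃ + hd₂ - hd₁) / 8 - (hv₄ - hv₃ - hv₂ + hv₁) / 8
    simpa [hhx.ne', hhy.ne'] using this
  refine ⟨4 * a 4 0, 2 / 3 * a 2 2, fun x y => ?_⟩
  simp [Finset.sum_range_succ, Derivation.leibniz, Derivation.leibniz_pow, pderiv_X, pderiv_ofNat,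
    h₂₀, h₃₀, h₂₁, h₃₁]
  ring

/-- For `u ∈ P₄`, `p ∈ Q_Ad` an Adini interpolant of `u` on the rectangle
`K = [x_c-h_x, x_c+h_x] × [y_c-h_y, y_c+h_y]`, and any `v ∈ Q_Ad`,
`∫_K (u-p)_xx v_xx = -(h_y²/3) ∫_K u_xxyy v_xx`. -/
theorem adini_expansion_identity_xx (xc yc hx hy : ℝ) (hhx : 0 < hx) (hhy : 0 < hy)
    (u p v : MvPolynomial (Fin 2) ℝ) (hu : u.totalDegree ≤ 4) (hp : p ∈ QAd)
    (hv : v ∈ QAd)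
    (hval : ∀ s ∈ ({-1, 1} : Set ℝ), ∀ t ∈ ({-1, 1} : Set ℝ),
      eval ![xc + s * hx, yc + t * hy] p = eval ![xc + s * hx, yc + t * hy] u)
    (hgrad : ∀ s ∈ ({-1, 1} : Set ℝ), ∀ t ∈ ({-1, 1} : Set ℝ),
      eval ![xc + s * hx, yc + t * hy] (pderiv 0 p) =
        eval ![xc + s * hx, yc + t * hy] (pderiv 0 u) ∧
      eval ![xc + s * hx, yc + t * hy] (pderiv 1 p) =
        eval ![xc + s * hx, yc + t * hy] (pderiv 1 u)) :
    (∫ z in (Set.Icc (xc - hx) (xc + hx) ×ˢ Set.Icc (yc - hy) (yc + hy) : Set (ℝ × ℝ)),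
        eval ![z.1, z.2] (pderiv 0 (pderiv 0 (u - p))) *
          eval ![z.1, z.2] (pderiv 0 (pderiv 0 v))) =
      -(hy ^ 2 / 3) *
        (∫ z in (Set.Icc (xc - hx) (xc + hx) ×ˢ Set.Icc (yc - hy) (yc + hy) : Set (ℝ × ℝ)),
          eval ![z.1, z.2] (pderiv 0 (pderiv 0 (pderiv 1 (pderiv 1 u)))) *
            eval ![z.1, z.2] (pderiv 0 (pderiv 0 v))) := by
  obtain ⟨A, B, hAB⟩ := exists_eval_pderiv_pderiv_eq_legendre (xc := xc) (yc := yc) hhx hhy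
    (e := u - p) ((totalDegree_sub _ _).trans (max_le hu (QAd.totalDegree_le hp)))
    (fun s hs t ht => by rw [map_sub, hval s hs t ht, sub_self])
    (fun s hs t ht => by rw [map_sub, map_sub, (hgrad s hs t ht).1, sub_self])
  obtain ⟨α, β, γ, δ, hw⟩ := QAd.exists_eval_pderiv_pderiv_eq xc yc hv
  have hxxyy : pderiv 0 (pderiv 0 (pderiv 1 (pderiv 1 (u - p)))) =
      pderiv 0 (pderiv 0 (pderiv 1 (pderiv 1 u))) := by
    simp only [map_sub, QAd.pderiv_xxyy_eq_zero hp, sub_zero]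
  rw [hxxyy] at hAB
  have hcont : ∀ f : MvPolynomial (Fin 2) ℝ, Continuous fun z : ℝ × ℝ => eval ![z.1, z.2] f :=
    fun f => (continuous_eval f).comp (by fun_prop)
  have hint : ∀ f g : MvPolynomial (Fin 2) ℝ, IntegrableOn
      (fun z : ℝ × ℝ => eval ![z.1, z.2] f * eval ![z.1, z.2] g)
      (Set.Icc (xc - hx) (xc + hx) ×ˢ Set.Icc (yc - hy) (yc + hy)) := fun f g =>
    ((hcont f).mul (hcont g)).continuousOn.integrableOn_compact
      (isCompact_Icc.prod isCompact_Icc)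
  have hzero := integral_legendre_mul_bilinear_eq_zero xc yc hx hy A B α β γ δ hhx hhy
  simp only [← hAB, ← hw, add_mul, mul_assoc] at hzero
  rw [integral_add (hint _ _) ((hint _ _).const_mul _), integral_const_mul] at hzero
  linarith
end
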